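/- The ℚ-algebra homomorphism from the free associative ℚ-algebra on four generators to U_4 that sends the four generators to the classes of Y_{{1,2,4}}, Y_{{1,3,4}}, Y_{{2,3,4}}, Y_{{1,2,3,4}} is injective; equivalently, these four classes generate a free associative subalgebra of U_4. (For n = 4 the ideal J_4 is generated by the single element Σ (Y_{T₁}Y_{T₂} + Y_{T₂}Y_{T₁}), summed over the ten unordered pairs {T₁, T₂} of distinct subsets of {1,2,3,4} of cardinality ≥ 3 with T₁ ∩ T₂ ≠ ∅ and T₁ ∪ T₂ = {1,2,3,4}.) -/

import Mathlib

/-!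
For `n ≥ 3` let `W n = {S ⊆ {1,…,n} : |S| ≥ 3}` and let `F n` be the free associative
`ℚ`-algebra on generators `Y S`, `S ∈ W n`.  Let `U n = F n / J n`, where `J n` is the
two-sided ideal generated by:
(a) `Y S * Y T + Y T * Y S` for `S ∩ T = ∅`;
(b) for each `S ⊆ {1,…,n}` with `|S| > 3`, the element `Σ (Y T₁ * Y T₂ + Y T₂ * Y T₁)`,
    the sum over all unordered pairs `{T₁, T₂}` of distinct elements of `W n` with
    `T₁ ∩ T₂ ≠ ∅` and `T₁ ∪ T₂ = S` (equivalently, the sum of `Y T₁ * Y T₂` over all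
    ordered pairs `(T₁, T₂)` of distinct elements with these properties);
(c) for each `T ⊊ S ⊆ {1,…,n}` with `|T| ≥ 3`, `|S ∖ T| > 1`, the element
    `Σ_{K ∈ W n, T ∪ K = S} (Y T * Y K + Y K * Y T)`.
`U n` is the quadratic dual of `H^•(M̄_{0,n+1}; ℚ)`, i.e. the Pontryagin ring
`H_•(Ω M̄_{0,n+1}; ℚ)`.  The quotient is realized as a `RingQuot` by the relations
identifying each generator of `J n` with `0`.
-/

/-- Subsets of `{1,…,n}` of cardinality at least `3`, as a `Finset`. -/
def WFin (n : ℕ) : Finset (Finset ℕ) :=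
  (Finset.Icc 1 n).powerset.filter fun S => 3 ≤ S.card

/-- The index type of the generators `Y S`. -/
abbrev W (n : ℕ) := {S : Finset ℕ // S ∈ WFin n}

/-- The free associative `ℚ`-algebra on the generators `Y S`, `S ∈ W n`. -/
abbrev F (n : ℕ) := FreeAlgebra ℚ (W n)

/-- The generator `Y S` of `F n`. -/
def Y {n : ℕ} (S : W n) : F n := FreeAlgebra.ι ℚ S

/-- The generating elements of the two-sided ideal `J n`. -/
def idealGens (n : ℕ) : Set (F n) :=
  -- (a)
  {x | ∃ S T : W n, S.1 ∩ T.1 = ∅ ∧ x = Y S * Y T + Y T * Y S} ∪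
  -- (b)
  {x | ∃ S : Finset ℕ, S ⊆ Finset.Icc 1 n ∧ 3 < S.card ∧
        x = ∑ p ∈ Finset.univ.filter (fun p : W n × W n =>
              p.1 ≠ p.2 ∧ (p.1.1 ∩ p.2.1).Nonempty ∧ p.1.1 ∪ p.2.1 = S),
              Y p.1 * Y p.2} ∪
  -- (c)
  {x | ∃ T : W n, ∃ S : Finset ℕ, T.1 ⊂ S ∧ S ⊆ Finset.Icc 1 n ∧ 1 < (S \ T.1).card ∧
        x = ∑ K ∈ Finset.univ.filter (fun K : W n => T.1 ∪ K.1 = S),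
              (Y T * Y K + Y K * Y T)}

/-- The relation identifying each generator of `J n` with `0`. -/
inductive URel (n : ℕ) : F n → F n → Prop
  | mk : ∀ x ∈ idealGens n, URel n x 0

/-- The quotient algebra `U n = F n / J n`. -/
abbrev U (n : ℕ) := RingQuot (URel n)

open FreeAlgebra in
/-- In the endomorphism algebra of a free algebra, left multiplication by a generator `s`
can be completed to a solution `a` of `a * s + s * a = r`, for every `r`. -/
theorem exists_anticommutator_eq {X : Type*} (s : X) (r : FreeAlgebra ℚ X) :
    ∃ a : Module.End ℚ (FreeAlgebra ℚ X),
      a * Algebra.lmul ℚ _ (ι ℚ s) + Algebra.lmul ℚ _ (ι ℚ s) * a = Algebra.lmul ℚ _ r := by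
  classical
  let b := FreeAlgebra.basisFreeMonoid ℚ X
  have hb (i : X) (w : FreeMonoid X) : b (FreeMonoid.of i * w) = ι ℚ i * b w := by
    simp [b, FreeAlgebra.basisFreeMonoid, FreeAlgebra.equivMonoidAlgebraFreeMonoid]
  let f (w : FreeMonoid X) : FreeAlgebra ℚ X :=
    FreeMonoid.recOn w 0 fun i w y => if i = s then r * b w - ι ℚ s * y else 0
  refine ⟨b.constr ℚ f, b.ext fun w => ?_⟩
  have hf : f (FreeMonoid.of s * w) = r * b w - ι ℚ s * f w := by simp [f]
  simp [← hb, b.constr_basis, hf]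

/-- The change of variables `x₃ ↦ x₃ - x₀ - x₁ - x₂` of the free algebra. -/
noncomputable def shear : FreeAlgebra ℚ (Fin 4) →ₐ[ℚ] FreeAlgebra ℚ (Fin 4) :=
  FreeAlgebra.lift ℚ ![FreeAlgebra.ι ℚ 0, FreeAlgebra.ι ℚ 1, FreeAlgebra.ι ℚ 2,
    FreeAlgebra.ι ℚ 3 - FreeAlgebra.ι ℚ 0 - FreeAlgebra.ι ℚ 1 - FreeAlgebra.ι ℚ 2]

theorem shear_injective : Function.Injective shear := by
  let ψ : FreeAlgebra ℚ (Fin 4) →ₐ[ℚ] FreeAlgebra ℚ (Fin 4) :=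
    FreeAlgebra.lift ℚ ![FreeAlgebra.ι ℚ 0, FreeAlgebra.ι ℚ 1, FreeAlgebra.ι ℚ 2,
      FreeAlgebra.ι ℚ 3 + FreeAlgebra.ι ℚ 0 + FreeAlgebra.ι ℚ 1 + FreeAlgebra.ι ℚ 2]
  have h : ψ.comp shear = AlgHom.id ℚ _ := by
    ext i
    fin_cases i <;> simp [ψ, shear]
    abel
  exact Function.LeftInverse.injective (g := ψ) fun x => DFunLike.congr_fun h x

/-- A sum over distinct pairs is the square of the sum minus the sum of the squares. -/
theorem sum_ne_mul_eq {ι R : Type*} [Fintype ι] [DecidableEq ι] [Ring R] (v : ι → R) :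
    ∑ p : ι × ι with p.1 ≠ p.2, v p.1 * v p.2 = (∑ i, v i) * (∑ i, v i) - ∑ i, v i * v i := by
  rw [eq_sub_iff_add_eq', Finset.sum_mul_sum, ← Finset.sum_product', Finset.univ_product_univ,
    ← Finset.sum_filter_add_sum_filter_not Finset.univ (fun p : ι × ι => p.1 = p.2)]
  congr 1
  rw [Finset.sum_filter, Fintype.sum_prod_type]
  simp

theorem eq_of_subset_Icc_of_three_lt_card {S : Finset ℕ} (hS : S ⊆ Finset.Icc 1 4) (h : 3 < S.card) :
    S = {1, 2, 3, 4} :=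
  Finset.eq_of_subset_of_card_le hS h

theorem WFin_four :
    WFin 4 = {{1, 2, 3}, {1, 2, 4}, {1, 3, 4}, {2, 3, 4}, {1, 2, 3, 4}} := by
  decide

theorem sum_W_four {M : Type*} [AddCommMonoid M] (v : Finset ℕ → M) :
    ∑ S : W 4, v S.1 =
      v {1, 2, 3} + (v {1, 2, 4} + (v {1, 3, 4} + (v {2, 3, 4} + v {1, 2, 3, 4}))) := by
  rw [Finset.sum_coe_sort (WFin 4) v, WFin_four]
  repeat rw [Finset.sum_insert (by decide)]
  rw [Finset.sum_singleton]

theorem ne_and_inter_nonempty_and_union_eq_iff (S T : W 4) :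
    (S ≠ T ∧ (S.1 ∩ T.1).Nonempty ∧ S.1 ∪ T.1 = {1, 2, 3, 4}) ↔ S ≠ T := by
  revert S T
  decide

/-- For `n = 4` the ideal is generated by a single quadratic element. -/
theorem eq_of_mem_idealGens_four {x : F 4} (hx : x ∈ idealGens 4) :
    x = (∑ S : W 4, Y S) * (∑ S : W 4, Y S) - ∑ S : W 4, Y S * Y S := by
  rcases hx with (⟨S, T, h, -⟩ | ⟨S, hS, hc, rfl⟩) | ⟨T, S, hTS, hS, hc, -⟩
  · exact absurd h (by revert S T; decide)
  · obtain rfl := eq_of_subset_Icc_of_three_lt_card hS hc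
    simp only [ne_and_inter_nonempty_and_union_eq_iff]
    exact sum_ne_mul_eq _
  · have hT : 3 ≤ T.1.card := (Finset.mem_filter.mp T.2).2
    have h4 : S.card ≤ 4 := by simpa using Finset.card_le_card hS
    have := Finset.card_sdiff_add_card_eq_card hTS.subset
    omega

/-- the `ℚ`-algebra homomorphism from the free associative algebra on four
generators to `U 4` sending the generators to the classes of `Y {1,2,4}`, `Y {1,3,4}`,
`Y {2,3,4}`, `Y {1,2,3,4}` is injective; equivalently, these four classes generate a free
associative subalgebra of `U 4`. -/
theorem free_subalgebra_U4 (g : Fin 4 → W 4)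
    (h0 : (g 0).1 = {1, 2, 4}) (h1 : (g 1).1 = {1, 3, 4})
    (h2 : (g 2).1 = {2, 3, 4}) (h3 : (g 3).1 = {1, 2, 3, 4}) :
    Function.Injective
      (FreeAlgebra.lift ℚ (fun i : Fin 4 => RingQuot.mkAlgHom ℚ (URel 4) (Y (g i))) :
        FreeAlgebra ℚ (Fin 4) →ₐ[ℚ] U 4) := by
  obtain ⟨a, ha⟩ := exists_anticommutator_eq (3 : Fin 4)
    (∑ i, shear (FreeAlgebra.ι ℚ i) * shear (FreeAlgebra.ι ℚ i) -
      FreeAlgebra.ι ℚ 3 * FreeAlgebra.ι ℚ 3)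
  let L : FreeAlgebra ℚ (Fin 4) →ₐ[ℚ] Module.End ℚ (FreeAlgebra ℚ (Fin 4)) :=
    (Algebra.lmul ℚ _).comp shear
  let x (i : Fin 4) := L (FreeAlgebra.ι ℚ i)
  let v (S : Finset ℕ) : Module.End ℚ (FreeAlgebra ℚ (Fin 4)) :=
    if S = {1, 2, 3} then a else if S = {1, 2, 4} then x 0 else if S = {1, 3, 4} then x 1
    else if S = {2, 3, 4} then x 2 else x 3
  have v0 : v {1, 2, 3} = a := if_pos rfl
  have v1 : v {1, 2, 4} = x 0 := by rw [show v {1, 2, 4} = _ from if_neg (by decide), if_pos rfl]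
  have v2 : v {1, 3, 4} = x 1 := by
    simp only [v]
    rw [if_neg (by decide), if_neg (by decide), if_pos trivial]
  have v3 : v {2, 3, 4} = x 2 := by
    simp only [v]
    rw [if_neg (by decide), if_neg (by decide), if_neg (by decide), if_pos trivial]
  have v4 : v {1, 2, 3, 4} = x 3 := by
    simp only [v]
    rw [if_neg (by decide), if_neg (by decide), if_neg (by decide), if_neg (by decide)]
  let Φ : F 4 →ₐ[ℚ] Module.End ℚ (FreeAlgebra ℚ (Fin 4)) := FreeAlgebra.lift ℚ fun S => v S.1
  have hY (S : W 4) : Φ (Y S) = v S.1 := FreeAlgebra.lift_ι_apply _ _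
  have hs : x 0 + (x 1 + (x 2 + x 3)) = Algebra.lmul ℚ _ (FreeAlgebra.ι ℚ 3) := by
    simp only [x, L, ← map_add, AlgHom.comp_apply]
    congr 1
    simp only [map_add, shear, FreeAlgebra.lift_ι_apply]
    simp
  have hrel : ∀ ⦃y z : F 4⦄, URel 4 y z → Φ y = Φ z := by
    rintro y _ ⟨hy⟩
    rw [eq_of_mem_idealGens_four hy]
    simp only [map_sub, map_mul, map_sum, map_zero, hY]
    rw [sum_W_four v, sum_W_four fun S => v S * v S, v0, v1, v2, v3, v4, hs]
    simp only [map_sub, map_add, map_mul, Fin.sum_univ_four] at ha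
    rw [← sub_eq_zero] at ha
    rw [← ha]
    simp only [x, L, AlgHom.comp_apply]
    noncomm_ring
  let Ψ : U 4 →ₐ[ℚ] Module.End ℚ (FreeAlgebra ℚ (Fin 4)) :=
    RingQuot.liftAlgHom ℚ ⟨Φ, hrel⟩
  have hcomp : Ψ.comp (FreeAlgebra.lift ℚ fun i : Fin 4 =>
      RingQuot.mkAlgHom ℚ (URel 4) (Y (g i))) = L := by
    ext1
    funext i
    have hi : v (g i).1 = x i := by
      fin_cases i
      · exact (congrArg v h0).trans v1
      · exact (congrArg v h1).trans v2
      · exact (congrArg v h2).trans v3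
      · exact (congrArg v h3).trans v4
    simp [Ψ, hY, hi, x]
  have hL : Function.Injective L :=
    Algebra.lmul_injective.comp shear_injective
  rw [← hcomp] at hL
  exact Function.Injective.of_comp hL
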